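/- arXiv:1701.05036 — 3 statements merged into one kernel-verified Lean document; each statement's English description precedes it below -/
import Mathlib

section
/- Let I be an index set (type) of cardinality at most 2^{ℵ₀}. Then there is a function F : I × ℕ → ℕ such that for every finite subset {i₁,…,i_l} ⊆ I of pairwise distinct indices and every choice of values a₁,…,a_l ∈ ℕ, there exists n ∈ ℕ with F(i_k, n) = a_k for all k = 1,…,l. -/
theorem exists_injOn_filter_range {I : Type*} {f : I → Set ℕ} (hf : Function.Injective f)
    (G : Finset I) [∀ i, DecidablePred (· ∈ f i)] :
    ∃ N : ℕ, Set.InjOn (fun i => {k ∈ Finset.range N | k ∈ f i}) G := by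
  have separated : ∀ᶠ N in Filter.atTop, ∀ i ∈ G, ∀ j ∈ G,
      {k ∈ Finset.range N | k ∈ f i} = {k ∈ Finset.range N | k ∈ f j} → i = j := by
    simp only [Finset.eventually_all]
    intro i _ j _
    by_cases hij : i = j
    · exact .of_forall fun _ _ => hij
    obtain ⟨d, hd⟩ : ∃ d, ¬(d ∈ f i ↔ d ∈ f j) := by
      by_contra! h
      exact hij (hf (Set.ext h))
    filter_upwards [Filter.eventually_gt_atTop d] with N hN h
    exact absurd (by simpa [hN] using Finset.ext_iff.mp h d) hd
  obtain ⟨N, hN⟩ := separated.exists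
  exact ⟨N, fun i hi j hj h => hN i hi j hj h⟩

theorem Finsupp.exists_apply_eq_of_injOn {I α M : Type*} [AddCommMonoid M] {t : I → α}
    {G : Finset I} (ht : Set.InjOn t G) (a : I → M) : ∃ g : α →₀ M, ∀ i ∈ G, g (t i) = a i := by
  refine ⟨∑ j ∈ G, Finsupp.single (t j) (a j), fun i hi => ?_⟩
  rw [Finsupp.finsetSum_apply, Finset.sum_eq_single_of_mem i hi, Finsupp.single_eq_same]
  intro j hj hji
  exact Finsupp.single_eq_of_ne fun h => hji (ht hj hi h.symm)

/-- The Engelking–Karłowicz property: if `I` has cardinality at most `2^ℵ₀`, then there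
is a function `F : I × ℕ → ℕ` realizing every finite partial assignment from `I` to `ℕ`
at some column `n`. -/
theorem engelking_karlowicz {I : Type*} (hI : Cardinal.mk I ≤ Cardinal.continuum) :
    ∃ F : I × ℕ → ℕ, ∀ (G : Finset I) (a : I → ℕ), ∃ n : ℕ, ∀ i ∈ G, F (i, n) = a i := by
  classical
  obtain ⟨f⟩ : Nonempty (I ↪ Set ℕ) := by
    rw [← Cardinal.lift_mk_le']
    simpa using hI
  obtain ⟨e, he⟩ := exists_surjective_nat (ℕ × (Finset ℕ →₀ ℕ))
  refine ⟨fun p => (e p.2).2 {k ∈ Finset.range (e p.2).1 | k ∈ f p.1}, fun G a => ?_⟩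
  obtain ⟨N, hN⟩ := exists_injOn_filter_range f.injective G
  obtain ⟨g, hg⟩ := Finsupp.exists_apply_eq_of_injOn hN a
  obtain ⟨n, hn⟩ := he (N, g)
  exact ⟨n, fun i hi => by simpa [hn] using hg i hi⟩
end

section
/- Fix an integer n ≥ 2. Let I be an index set of cardinality at most 2^{ℵ₀}, and for each i ∈ I let P_i be a σ-n-linked partial order with a greatest element 𝟙_i. Then the finite-support product P = ∏_{i∈I} P_i, consisting of all functions p with p(i) ∈ P_i for all i and p(i) = 𝟙_i for all but finitely many i, ordered coordinatewise, is σ-n-linked. -/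
/-- A subset `C` of a partial order is `n`-linked if any `n` elements of `C`
have a common lower bound in `P`. -/
def NLinked {P : Type*} [PartialOrder P] (n : ℕ) (C : Set P) : Prop :=
  ∀ f : Fin n → P, (∀ i, f i ∈ C) → ∃ b : P, ∀ i, b ≤ f i

/-- `P` is σ-`n`-linked if it is the union of countably many `n`-linked subsets. -/
def SigmaNLinked (n : ℕ) (P : Type*) [PartialOrder P] : Prop :=
  ∃ Q : ℕ → Set P, (∀ k, NLinked n (Q k)) ∧ ∀ p : P, ∃ k, p ∈ Q k

/-- The finite-support product of a family of partial orders with greatest elements: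
functions equal to the greatest element in all but finitely many coordinates. -/
def FinSuppProd {I : Type*} (P : I → Type*) [∀ i, PartialOrder (P i)]
    [∀ i, OrderTop (P i)] : Type _ :=
  {p : ∀ i, P i // {i | p i ≠ ⊤}.Finite}

/-- The finite-support product is ordered coordinatewise. -/
instance {I : Type*} (P : I → Type*) [∀ i, PartialOrder (P i)] [∀ i, OrderTop (P i)] :
    PartialOrder (FinSuppProd P) :=
  inferInstanceAs (PartialOrder {p : ∀ i, P i // {i | p i ≠ ⊤}.Finite})

/-- The initial segment below `m` of a set of naturals, as a finset. -/
noncomputable def truncation (m : ℕ) (s : Set ℕ) : Finset ℕ :=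
  open Classical in (Finset.range m).filter (· ∈ s)

/-- Finitely many distinct sets of naturals are separated by long enough truncations. -/
theorem eventually_injOn_truncation {T : Set (Set ℕ)} (hT : T.Finite) :
    ∀ᶠ m in Filter.atTop, Set.InjOn (truncation m) T := by
  have key : ∀ᶠ m in Filter.atTop, ∀ s ∈ T, ∀ t ∈ T, truncation m s = truncation m t → s = t := by
    refine (Filter.eventually_all_finite hT).2 fun s _ =>
      (Filter.eventually_all_finite hT).2 fun t _ => ?_
    by_cases hst : s = t
    · exact Filter.Eventually.of_forall fun _ _ => hst
    · obtain ⟨x, hx⟩ : ∃ x, ¬(x ∈ s ↔ x ∈ t) := by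
        by_contra! hall
        exact hst (Set.ext hall)
      filter_upwards [Filter.eventually_gt_atTop x] with m hm heq
      refine absurd ?_ hx
      have := congrArg (x ∈ ·) heq
      simpa [truncation, hm] using this
  filter_upwards [key] with m hm s hs t ht using hm s hs t ht

/-- To bound `n` elements each of which is the top element or lies in an `n`-linked set,
the `n`-linked set suffices. -/
theorem NLinked.exists_le_of_mem_or_eq_top {P : Type*} [PartialOrder P] [OrderTop P] {n : ℕ}
    {C : Set P} (hC : NLinked n C) (f : Fin n → P) (hf : ∀ k, f k ≠ ⊤ → f k ∈ C) :
    ∃ b : P, ∀ k, b ≤ f k := by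
  classical
  by_cases hall : ∀ k, f k = ⊤
  · exact ⟨⊤, fun k => (hall k).ge⟩
  · push Not at hall
    obtain ⟨k₀, hk₀⟩ := hall
    obtain ⟨b, hb⟩ := hC (fun k => if f k = ⊤ then f k₀ else f k) fun k => by
      by_cases hk : f k = ⊤
      · simpa [hk] using hf k₀ hk₀
      · simpa [hk] using hf k hk
    refine ⟨b, fun k => ?_⟩
    by_cases hk : f k = ⊤
    · simp [hk]
    · simpa [hk] using hb k

/-- A union of `n`-linked subsets indexed by a countable nonempty type witnesses
σ-`n`-linkedness. -/
theorem SigmaNLinked.of_countable {P : Type*} [PartialOrder P] {n : ℕ} {ι : Type*} [Countable ι]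
    [Nonempty ι] (Q : ι → Set P) (hQ : ∀ c, NLinked n (Q c)) (hcover : ∀ p, ∃ c, p ∈ Q c) :
    SigmaNLinked n P := by
  obtain ⟨u, hu⟩ := exists_surjective_nat ι
  refine ⟨fun k => Q (u k), fun k => hQ (u k), fun p => ?_⟩
  obtain ⟨c, hc⟩ := hcover p
  obtain ⟨k, rfl⟩ := hu c
  exact ⟨k, hc⟩

/-- A family of `n`-linked sets, one for each coordinate, defines an `n`-linked subset of the
finite-support product. -/
theorem FinSuppProd.nLinked {I : Type*} {P : I → Type*} [∀ i, PartialOrder (P i)]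
    [∀ i, OrderTop (P i)] {n : ℕ} {C : ∀ i, Set (P i)} (hC : ∀ i, NLinked n (C i)) :
    NLinked n {p : FinSuppProd P | ∀ i, p.1 i ≠ ⊤ → p.1 i ∈ C i} := by
  classical
  intro f hf
  choose b hb using fun i =>
    (hC i).exists_le_of_mem_or_eq_top (fun k => (f k).1 i) fun k => hf k i
  have hfin : (⋃ k, {i | (f k).1 i ≠ ⊤}).Finite := Set.finite_iUnion fun k => (f k).2
  refine ⟨⟨fun i => if ∀ k, (f k).1 i = ⊤ then ⊤ else b i, hfin.subset fun i hi => ?_⟩,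
    fun k i => ?_⟩
  · by_contra hnot
    simp only [Set.mem_iUnion, Set.mem_ofPred_eq, not_exists, not_not] at hnot
    exact hi (if_pos hnot)
  · by_cases hall : ∀ k, (f k).1 i = ⊤
    · exact le_top.trans_eq (hall k).symm
    · exact (if_neg hall).trans_le (hb i k)

/-- For fixed `n ≥ 2`, the finite-support product of at most continuum many
σ-`n`-linked partial orders is σ-`n`-linked. -/
theorem finSuppProd_sigmaNLinked (n : ℕ) (hn : 2 ≤ n) {I : Type*} (P : I → Type*)
    [∀ i, PartialOrder (P i)] [∀ i, OrderTop (P i)]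
    (hI : Cardinal.mk I ≤ Cardinal.continuum)
    (h : ∀ i, SigmaNLinked n (P i)) : SigmaNLinked n (FinSuppProd P) := by
  classical
  obtain ⟨e⟩ : Nonempty (I ↪ Set ℕ) := by
    rw [← Cardinal.lift_mk_le', Cardinal.mk_set_nat]
    simpa using hI
  choose Q hQ hcover using h
  refine SigmaNLinked.of_countable (ι := ℕ × (Finset ℕ →₀ ℕ))
    (fun c => {p | ∀ i, p.1 i ≠ ⊤ → p.1 i ∈ Q i (c.2 (truncation c.1 (e i)))})
    (fun c => FinSuppProd.nLinked fun i => hQ i _) fun p => ?_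
  choose color hcolor using fun i => hcover i (p.1 i)
  obtain ⟨m, hm⟩ := (eventually_injOn_truncation (p.2.image e)).exists
  refine ⟨(m, ∑ i ∈ p.2.toFinset, Finsupp.single (truncation m (e i)) (color i)), fun i hi => ?_⟩
  suffices hval : (∑ j ∈ p.2.toFinset, Finsupp.single (truncation m (e j)) (color j))
      (truncation m (e i)) = color i by
    simpa only [hval] using hcolor i
  rw [Finsupp.finsetSum_apply, Finset.sum_eq_single i]
  · simp
  · intro j hj hji
    refine Finsupp.single_eq_of_ne fun heq => hji ?_
    have hj' : j ∈ {i | p.1 i ≠ ⊤} := p.2.mem_toFinset.1 hj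
    exact (e.injective (hm (Set.mem_image_of_mem e hi) (Set.mem_image_of_mem e hj') heq)).symm
  · exact fun hi' => absurd (p.2.mem_toFinset.2 hi) hi'
end

section
/- Let A be a set of functions ℕ → ℕ and let P(A) be the genericity-killing poset. For every finite sequence s ∈ ℕ^{<ω} and every N ∈ ℕ, the set D_{s,N} = {⟨u,F⟩ ∈ P(A) : there exists t ∈ u extending s with length greater than N} is dense and open in P(A). -/
/-- A finite sequence `s` is an initial segment of `f : ℕ → ℕ` if `s k = f k` for
all `k` below the length of `s`. -/
def IsInitSeg (s : List ℕ) (f : ℕ → ℕ) : Prop :=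
  ∀ k : Fin s.length, s.get k = f k

/-- The genericity-killing poset `P(A)`: conditions are pairs `⟨u, F⟩` with `u` a
finite set of finite sequences and `F` a finite subset of `A`. -/
def GKCond (A : Set (ℕ → ℕ)) : Type :=
  {p : Finset (List ℕ) × Finset (ℕ → ℕ) // ↑p.2 ⊆ A}

/-- The order on `P(A)`: `⟨u', F'⟩ ≤ ⟨u, F⟩` iff `u ⊆ u'`, `F ⊆ F'`, and for every
`f ∈ F` and every `t ∈ u' \ u`, `t` is not an initial segment of `f`. -/
instance (A : Set (ℕ → ℕ)) : PartialOrder (GKCond A) where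
  le p q := q.1.1 ⊆ p.1.1 ∧ q.1.2 ⊆ p.1.2 ∧
    ∀ f ∈ q.1.2, ∀ t ∈ p.1.1, t ∉ q.1.1 → ¬ IsInitSeg t f
  le_refl p := ⟨subset_rfl, subset_rfl, fun _ _ t ht hnt => (hnt ht).elim⟩
  le_trans p q r hpq hqr := by
    refine ⟨hqr.1.trans hpq.1, hqr.2.1.trans hpq.2.1, fun f hf t htp htr => ?_⟩
    by_cases htq : t ∈ q.1.1
    · exact hqr.2.2 f hf t htq htr
    · exact hpq.2.2 f (hqr.2.1 hf) t htp htq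
  le_antisymm p q hpq hqp :=
    Subtype.ext (Prod.ext (Finset.Subset.antisymm hqp.1 hpq.1)
      (Finset.Subset.antisymm hqp.2.1 hpq.2.1))

/-- Any finite sequence has arbitrarily long extensions that are initial segments of none of
finitely many given functions. -/
theorem exists_long_ext_not_isInitSeg (F : Finset (ℕ → ℕ)) (s : List ℕ) (N : ℕ) :
    ∃ t : List ℕ, s <+: t ∧ N < t.length ∧ ∀ f ∈ F, ¬ IsInitSeg t f := by
  obtain ⟨m, hm⟩ := Infinite.exists_notMem_finset (F.image fun f => f s.length)
  refine ⟨s ++ List.replicate (N + 1) m, List.prefix_append _ _, ?_, fun f hf h => hm ?_⟩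
  · simp only [List.length_append, List.length_replicate]
    omega
  · have hk := h ⟨s.length, by simp⟩
    simp only [List.get_eq_getElem, List.getElem_append_right le_rfl,
      List.getElem_replicate] at hk
    exact Finset.mem_image.mpr ⟨f, hf, hk.symm⟩

/-- For every finite sequence `s` and every `N`, the set `D_{s,N}` of conditions
containing some `t` extending `s` of length greater than `N` is dense and open
in `P(A)`. -/
theorem gk_dense_open_long_ext (A : Set (ℕ → ℕ)) (s : List ℕ) (N : ℕ) :
    (∀ p : GKCond A, ∃ q : GKCond A, q ≤ p ∧
        ∃ t ∈ q.1.1, s <+: t ∧ t.length > N) ∧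
    (∀ p : GKCond A, (∃ t ∈ p.1.1, s <+: t ∧ t.length > N) →
      ∀ q : GKCond A, q ≤ p → ∃ t ∈ q.1.1, s <+: t ∧ t.length > N) := by
  refine ⟨fun p => ?_, fun p ⟨t, ht, hst⟩ q hqp => ⟨t, hqp.1 ht, hst⟩⟩
  obtain ⟨t, hst, hN, ht⟩ := exists_long_ext_not_isInitSeg p.1.2 s N
  refine ⟨⟨(insert t p.1.1, p.1.2), p.2⟩, ⟨Finset.subset_insert _ _, subset_rfl, ?_⟩,
    t, Finset.mem_insert_self _ _, hst, hN⟩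
  intro f hf r hr hrp
  obtain rfl := (Finset.mem_insert.mp hr).resolve_right hrp
  exact ht f hf
end
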